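/- (λnsub Typed Genericity) Let t be a meaningless term of the λnsub-calculus. If there is a derivation in type system N of the judgment Γ ⊢ C⟨t⟩ : σ for some full context C, typing context Γ and type σ, then for every term u there is a derivation in system N of Γ ⊢ C⟨u⟩ : σ. -/

import Mathlib

/-- `i`-fold composition of a relation: `nSteps R i a b` holds iff `a` goes to
`b` in exactly `i` `R`-steps. -/
def nSteps {α : Type} (R : α → α → Prop) : ℕ → α → α → Prop
  | 0, a, b => a = b
  | n + 1, a, b => ∃ c, R a c ∧ nSteps R n c b

/-- Terms of the λnsub-calculus (call-by-name with explicit substitutions at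
a distance): `sub t x u` is the explicit substitution `t[x←u]`, binding `x`
in `t`. -/
inductive NTerm : Type
  | var : ℕ → NTerm
  | lam : ℕ → NTerm → NTerm
  | app : NTerm → NTerm → NTerm
  | sub : NTerm → ℕ → NTerm → NTerm

/-- Free variables. -/
def NTerm.fv : NTerm → Finset ℕ
  | .var x => {x}
  | .lam x t => NTerm.fv t \ {x}
  | .app t u => NTerm.fv t ∪ NTerm.fv u
  | .sub t x u => (NTerm.fv t \ {x}) ∪ NTerm.fv u

/-- Meta-level substitution `t{x:=u}`. -/
def NTerm.subst : NTerm → ℕ → NTerm → NTerm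
  | .var y, x, v => if y = x then v else .var y
  | .lam y t, x, v => if y = x then .lam y t else .lam y (NTerm.subst t x v)
  | .app t u, x, v => .app (NTerm.subst t x v) (NTerm.subst u x v)
  | .sub t y u, x, v =>
      if y = x then .sub t y (NTerm.subst u x v)
      else .sub (NTerm.subst t x v) y (NTerm.subst u x v)

/-- List contexts `L ::= ⟨⟩ | L[x←t]`. -/
inductive NLCtx : Type
  | hole : NLCtx
  | sub : NLCtx → ℕ → NTerm → NLCtx

def NLCtx.plug : NLCtx → NTerm → NTerm
  | .hole, t => t
  | .sub L x u, t => NTerm.sub (NLCtx.plug L t) x u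

def NLCtx.binders : NLCtx → Finset ℕ
  | .hole => ∅
  | .sub L x _ => insert x (NLCtx.binders L)

/-- Root rewrite rules (βn) and (sn); the side condition says that no free
variable of `t` is captured by the list context `L`. -/
inductive NRoot : NTerm → NTerm → Prop
  | beta (L : NLCtx) (x : ℕ) (s t : NTerm)
      (hcap : ∀ y ∈ NLCtx.binders L, y ∉ NTerm.fv t) :
      NRoot (.app (NLCtx.plug L (.lam x s)) t) (NLCtx.plug L (.sub s x t))
  | subn (t : NTerm) (x : ℕ) (u : NTerm) :
      NRoot (.sub t x u) (NTerm.subst t x u)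

/-- Stratified reduction `→_{n_k}` for `k ∈ ℕ∪{ω}`, where `ω` is `⊤ : ℕ∞`:
the closure of the root rules under stratified contexts `S_k`.  Abstraction
bodies and left subterms keep the same level, while argument positions
(`t S` and `t[x←S]`) raise the level by one; since `⊤ + 1 = ⊤`, level `⊤`
(i.e. `ω`, full reduction) allows reduction anywhere, while level `0`
(surface reduction) forbids reduction inside arguments. -/
inductive NStep : ℕ∞ → NTerm → NTerm → Prop
  | root (k : ℕ∞) {t u : NTerm} : NRoot t u → NStep k t u
  | lam {k : ℕ∞} (x : ℕ) {t t' : NTerm} :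
      NStep k t t' → NStep k (.lam x t) (.lam x t')
  | appL {k : ℕ∞} {t t' : NTerm} (u : NTerm) :
      NStep k t t' → NStep k (.app t u) (.app t' u)
  | appR {k : ℕ∞} (t : NTerm) {u u' : NTerm} :
      NStep k u u' → NStep (k + 1) (.app t u) (.app t u')
  | subL {k : ℕ∞} {t t' : NTerm} (x : ℕ) (u : NTerm) :
      NStep k t t' → NStep k (.sub t x u) (.sub t' x u)
  | subR {k : ℕ∞} (t : NTerm) (x : ℕ) {u u' : NTerm} :
      NStep k u u' → NStep (k + 1) (.sub t x u) (.sub t x u')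

/-- `S_k`-normal terms: no `→_{n_k}` step applies. -/
def NNormal (k : ℕ∞) (t : NTerm) : Prop := ∀ u, ¬ NStep k t u

/-- Testing contexts `T ::= ⟨⟩ | T u | (λx.T) u`. -/
inductive NTCtx : Type
  | hole : NTCtx
  | app : NTCtx → NTerm → NTCtx
  | lamApp : ℕ → NTCtx → NTerm → NTCtx

def NTCtx.plug : NTCtx → NTerm → NTerm
  | .hole, t => t
  | .app T u, t => .app (NTCtx.plug T t) u
  | .lamApp x T u, t => .app (.lam x (NTCtx.plug T t)) u

/-- A term is meaningful if some testing context sends it to the identity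
`λz.z` by surface reduction; otherwise it is meaningless. -/
def NMeaningful (t : NTerm) : Prop :=
  ∃ (T : NTCtx) (z : ℕ),
    Relation.ReflTransGen (NStep 0) (NTCtx.plug T t) (.lam z (.var z))

/-- Full (one-hole) contexts `C ::= ⟨⟩ | λx.C | C t | t C | C[x←t] | t[x←C]`. -/
inductive NFCtx : Type
  | hole : NFCtx
  | lam : ℕ → NFCtx → NFCtx
  | appL : NFCtx → NTerm → NFCtx
  | appR : NTerm → NFCtx → NFCtx
  | subL : NFCtx → ℕ → NTerm → NFCtx
  | subR : NTerm → ℕ → NFCtx → NFCtx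

def NFCtx.plug : NFCtx → NTerm → NTerm
  | .hole, t => t
  | .lam x C, t => .lam x (NFCtx.plug C t)
  | .appL C u, t => .app (NFCtx.plug C t) u
  | .appR u C, t => .app u (NFCtx.plug C t)
  | .subL C x u, t => .sub (NFCtx.plug C t) x u
  | .subR u x C, t => .sub u x (NFCtx.plug C t)

/-- Types of system 𝒩: type variables and arrows whose source is a multiset
type, represented as a list of types. -/
inductive NTy : Type
  | tvar : ℕ → NTy
  | arr : List NTy → NTy → NTy

/-- The empty typing context. -/
def NCtxEmpty : ℕ → List NTy := fun _ => []

/-- The typing context `x : M`. -/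
def NCtxSing (x : ℕ) (M : List NTy) : ℕ → List NTy :=
  fun y => if y = x then M else []

/-- Pointwise (multiset) sum of two typing contexts. -/
def NCtxAdd (Γ Δ : ℕ → List NTy) : ℕ → List NTy := fun y => Γ y ++ Δ y

/-- The typing context `Γ; x : M`. -/
def NCtxUpd (Γ : ℕ → List NTy) (x : ℕ) (M : List NTy) : ℕ → List NTy :=
  fun y => if y = x then M else Γ y

/-- Sum of a finite family of typing contexts. -/
def NCtxSum : List (ℕ → List NTy) → (ℕ → List NTy)
  | [] => NCtxEmpty
  | Γ :: Γs => NCtxAdd Γ (NCtxSum Γs)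

/-- Typing derivations of system 𝒩; finite families of premises are
represented as lists of pairs (context, type). -/
inductive NDer : (ℕ → List NTy) → NTerm → NTy → Prop
  | var (x : ℕ) (σ : NTy) : NDer (NCtxSing x [σ]) (.var x) σ
  | lam {Γ : ℕ → List NTy} (x : ℕ) {t : NTerm} (M : List NTy) (σ : NTy) :
      NDer (NCtxUpd Γ x M) t σ → NDer Γ (.lam x t) (.arr M σ)
  | app {Γ₁ : ℕ → List NTy} {t u : NTerm} (σ : NTy)
      (fam : List ((ℕ → List NTy) × NTy)) :
      NDer Γ₁ t (.arr (fam.map Prod.snd) σ) →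
      (∀ p ∈ fam, NDer p.1 u p.2) →
      NDer (NCtxAdd Γ₁ (NCtxSum (fam.map Prod.fst))) (.app t u) σ
  | es {Γ₁ : ℕ → List NTy} {t u : NTerm} (x : ℕ) (σ : NTy)
      (fam : List ((ℕ → List NTy) × NTy)) :
      NDer (NCtxUpd Γ₁ x (fam.map Prod.snd)) t σ →
      (∀ p ∈ fam, NDer p.1 u p.2) →
      NDer (NCtxAdd Γ₁ (NCtxSum (fam.map Prod.fst))) (.sub t x u) σ

/-- Simultaneous substitution; it is capture-avoiding whenever each `θ y` is closed or `var y`. -/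
def NTerm.psubst : NTerm → (ℕ → NTerm) → NTerm
  | .var y, θ => θ y
  | .lam y t, θ => .lam y (NTerm.psubst t (Function.update θ y (.var y)))
  | .app t u, θ => .app (NTerm.psubst t θ) (NTerm.psubst u θ)
  | .sub t y u, θ =>
      .sub (NTerm.psubst t (Function.update θ y (.var y))) y (NTerm.psubst u θ)

theorem NTerm.subst_eq_self {t : NTerm} {x : ℕ} (u : NTerm) (hx : x ∉ t.fv) :
    t.subst x u = t := by
  induction t with
  | var y => simp_all [NTerm.fv, NTerm.subst, eq_comm]
  | lam y t ih =>
    by_cases h : y = x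
    · simp [NTerm.subst, h]
    · have h' : x ≠ y := fun e => h e.symm
      simp_all [NTerm.fv, NTerm.subst]
  | app t s iht ihs => simp_all [NTerm.fv, NTerm.subst]
  | sub t y s iht ihs =>
    by_cases h : y = x
    · simp_all [NTerm.fv, NTerm.subst]
    · have h' : x ≠ y := fun e => h e.symm
      simp_all [NTerm.fv, NTerm.subst]

theorem NTerm.psubst_congr (t : NTerm) {θ θ' : ℕ → NTerm}
    (h : ∀ y ∈ t.fv, θ y = θ' y) : t.psubst θ = t.psubst θ' := by
  induction t generalizing θ θ' with
  | var y => exact h y (by simp [NTerm.fv])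
  | lam y t ih =>
    simp only [NTerm.psubst]
    congr 1
    refine ih fun z hz => ?_
    by_cases e : z = y
    · simp [e]
    · simpa [e] using h z (by simp [NTerm.fv, hz, e])
  | app t s iht ihs =>
    simp only [NTerm.psubst]
    rw [iht fun z hz => h z (by simp [NTerm.fv, hz]),
      ihs fun z hz => h z (by simp [NTerm.fv, hz])]
  | sub t y s iht ihs =>
    simp only [NTerm.psubst]
    rw [ihs fun z hz => h z (by simp [NTerm.fv, hz])]
    congr 1
    refine iht fun z hz => ?_
    by_cases e : z = y
    · simp [e]
    · simpa [e] using h z (by simp [NTerm.fv, hz, e])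

theorem NTerm.psubst_var (t : NTerm) : t.psubst .var = t := by
  induction t <;> simp_all [NTerm.psubst]

theorem NTerm.fv_psubst_subset (t : NTerm) (θ : ℕ → NTerm) (S : Finset ℕ)
    (h : ∀ y, (θ y).fv ⊆ S) : (t.psubst θ).fv ⊆ S := by
  have upd : ∀ {θ : ℕ → NTerm} {S : Finset ℕ} (y : ℕ), (∀ z, (θ z).fv ⊆ S) →
      ∀ z, (Function.update θ y (.var y) z).fv ⊆ insert y S := by
    intro θ S y h z
    by_cases e : z = y
    · simp [e, NTerm.fv]
    · simpa [e] using (h z).trans (Finset.subset_insert y S)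
  induction t generalizing θ S with
  | var y => exact h y
  | lam y t ih =>
    have := ih _ _ (upd y h)
    intro z hz
    simp only [NTerm.psubst, NTerm.fv, Finset.mem_sdiff, Finset.mem_singleton] at hz
    exact (Finset.mem_insert.1 (this hz.1)).resolve_left hz.2
  | app t s iht ihs =>
    exact Finset.union_subset (iht _ _ h) (ihs _ _ h)
  | sub t y s iht ihs =>
    have := iht _ _ (upd y h)
    refine Finset.union_subset (fun z hz => ?_) (ihs _ _ h)
    simp only [Finset.mem_sdiff, Finset.mem_singleton] at hz
    exact (Finset.mem_insert.1 (this hz.1)).resolve_left hz.2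

theorem NTerm.fv_psubst_eq_empty (t : NTerm) {θ : ℕ → NTerm} (h : ∀ y, (θ y).fv = ∅) :
    (t.psubst θ).fv = ∅ :=
  Finset.subset_empty.1 (t.fv_psubst_subset θ ∅ fun y => (h y).subset)

/-- Substitution composes with a simultaneous substitution of closed terms. -/
theorem NTerm.subst_psubst (t : NTerm) (x : ℕ) (u : NTerm) {θ : ℕ → NTerm}
    (h : ∀ y, θ y = .var y ∨ (θ y).fv = ∅) :
    (t.psubst θ).subst x u = t.psubst fun y => (θ y).subst x u := by
  have upd : ∀ {θ : ℕ → NTerm} (y : ℕ), (∀ y, θ y = .var y ∨ (θ y).fv = ∅) →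
      ∀ z, Function.update θ y (.var y) z = .var z ∨
        (Function.update θ y (.var y) z).fv = ∅ := by
    intro θ y h z
    by_cases e : z = y
    · simp [e]
    · simpa [e] using h z
  have comm_ne : ∀ {θ : ℕ → NTerm} {y : ℕ}, y ≠ x →
      (fun z => (Function.update θ y (.var y) z).subst x u) =
        Function.update (fun z => (θ z).subst x u) y (.var y) := by
    intro θ y hy
    funext z
    by_cases e : z = y
    · simp [e, NTerm.subst, hy]
    · simp [e]
  have comm_eq : ∀ {θ : ℕ → NTerm}, (∀ y, θ y = .var y ∨ (θ y).fv = ∅) →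
      Function.update (fun z => (θ z).subst x u) x (.var x) =
        Function.update θ x (.var x) := by
    intro θ h
    funext z
    by_cases e : z = x
    · simp [e]
    · rcases h z with h | h
      · simp [e, h, NTerm.subst]
      · simpa [e] using NTerm.subst_eq_self u (by simp [h])
  induction t generalizing θ with
  | var y => rfl
  | lam y t ih =>
    by_cases hy : y = x
    · subst hy
      simp [NTerm.psubst, NTerm.subst, comm_eq h]
    · simp [NTerm.psubst, NTerm.subst, hy, ih (upd y h), comm_ne hy]
  | app t s iht ihs => simp [NTerm.psubst, NTerm.subst, iht h, ihs h]
  | sub t y s iht ihs =>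
    by_cases hy : y = x
    · subst hy
      simp [NTerm.psubst, NTerm.subst, comm_eq h, ihs h]
    · simp [NTerm.psubst, NTerm.subst, hy, iht (upd y h), ihs h, comm_ne hy]

theorem NTerm.subst_psubst_update (t : NTerm) (x : ℕ) (u : NTerm) {θ : ℕ → NTerm}
    (h : ∀ y, (θ y).fv = ∅) :
    (t.psubst (Function.update θ x (.var x))).subst x u =
      t.psubst (Function.update θ x u) := by
  rw [NTerm.subst_psubst]
  · congr 1
    funext z
    by_cases e : z = x
    · simp [e, NTerm.subst]
    · simpa [e] using NTerm.subst_eq_self u (by simp [h])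
  · intro y
    by_cases e : y = x
    · simp [e]
    · simp [e, h]

/-- Application of a term to a list of arguments. -/
def NTerm.apps (t : NTerm) (ws : List NTerm) : NTerm := ws.foldl .app t

theorem NStep.apps {t t' : NTerm} (h : NStep 0 t t') (ws : List NTerm) :
    NStep 0 (t.apps ws) (t'.apps ws) := by
  induction ws generalizing t t' with
  | nil => exact h
  | cons w ws ih => exact ih (h.appL w)

theorem NStep.appLamToSub (x : ℕ) (s u : NTerm) :
    NStep 0 (.app (.lam x s) u) (.sub s x u) :=
  .root 0 (.beta .hole x s u (by simp [NLCtx.binders]))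

/-- Some list of arguments sends the term to the identity by surface reduction. -/
def NSolvable (t : NTerm) : Prop :=
  ∃ (ws : List NTerm) (z : ℕ), Relation.ReflTransGen (NStep 0) (t.apps ws) (.lam z (.var z))

/-- Reducibility predicate on terms, by recursion on types. -/
def NRed : NTy → NTerm → Prop
  | .tvar _, t => NSolvable t
  | .arr M σ, t => ∀ u, u.fv = ∅ → (∀ τ ∈ M, NRed τ u) → NRed σ (.app t u)

theorem NRed.expand : ∀ (σ : NTy) {t t' : NTerm}, NStep 0 t t' → NRed σ t' → NRed σ t
  | .tvar _, t, t', hs, h => by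
    rw [NRed] at h ⊢
    obtain ⟨ws, z, h⟩ := h
    exact ⟨ws, z, h.head (hs.apps ws)⟩
  | .arr M σ, t, t', hs, h => by
    rw [NRed] at h ⊢
    exact fun u hu hM => NRed.expand σ (hs.appL u) (h u hu hM)

/-- The term `λ…λ.λz.z` discarding `n` arguments. -/
def NEraser : ℕ → NTerm
  | 0 => .lam 0 (.var 0)
  | n + 1 => .lam 0 (NEraser n)

theorem fv_NEraser (n : ℕ) : (NEraser n).fv = ∅ := by
  induction n with
  | zero => simp [NEraser, NTerm.fv]
  | succ n ih => simp [NEraser, NTerm.fv, ih]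

theorem NEraser_toSub (n : ℕ) (u : NTerm) :
    NStep 0 (.app (NEraser (n + 1)) u) (.sub (NEraser n) 0 u) :=
  .appLamToSub 0 (NEraser n) u

theorem NEraser_ofSub (n : ℕ) (u : NTerm) :
    NStep 0 (.sub (NEraser n) 0 u) (NEraser n) := by
  have h := NStep.root 0 (NRoot.subn (NEraser n) 0 u)
  rwa [NTerm.subst_eq_self u (by simp [fv_NEraser])] at h

theorem NSolvable_NEraser (n : ℕ) : NSolvable (NEraser n) := by
  induction n with
  | zero => exact ⟨[], 0, .refl⟩
  | succ n ih =>
    obtain ⟨ws, z, h⟩ := ih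
    let u := NEraser 0
    exact ⟨u :: ws, z, (h.head ((NEraser_ofSub n u).apps ws)).head
      ((NEraser_toSub n u).apps ws)⟩

/-- Number of arrows along the right spine of a type. -/
def NTy.arity : NTy → ℕ
  | .tvar _ => 0
  | .arr _ σ => NTy.arity σ + 1

theorem NRed_NEraser : ∀ (σ : NTy) (n : ℕ), σ.arity ≤ n → NRed σ (NEraser n)
  | .tvar _, n, _ => by
    rw [NRed]
    exact NSolvable_NEraser n
  | .arr M σ, 0, h => by simp [NTy.arity] at h
  | .arr M σ, n + 1, h => by
    rw [NRed]
    intro u _ _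
    exact .expand σ (NEraser_toSub n u) <| .expand σ (NEraser_ofSub n u) <|
      NRed_NEraser σ n (by simpa [NTy.arity] using h)

/-- An eraser inhabiting every type of the multiset `M`. -/
def NEraserFor (M : List NTy) : NTerm := NEraser (M.map NTy.arity).sum

theorem NRed_NEraserFor {M : List NTy} {τ : NTy} (h : τ ∈ M) : NRed τ (NEraserFor M) :=
  NRed_NEraser τ _ (List.le_sum_of_mem (List.mem_map_of_mem h))

theorem NRed.solvable : ∀ (σ : NTy) {t : NTerm}, NRed σ t → NSolvable t
  | .tvar _, t, h => by rwa [NRed] at h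
  | .arr M σ, t, h => by
    rw [NRed] at h
    obtain ⟨ws, z, h⟩ := NRed.solvable σ
      (h (NEraserFor M) (fv_NEraser _) fun τ hτ => NRed_NEraserFor hτ)
    exact ⟨NEraserFor M :: ws, z, h⟩

theorem mem_NCtxSum {l : List (ℕ → List NTy)} {Γ : ℕ → List NTy} {y : ℕ} {τ : NTy}
    (hΓ : Γ ∈ l) (h : τ ∈ Γ y) : τ ∈ NCtxSum l y := by
  induction l with
  | nil => simp at hΓ
  | cons Δ l ih =>
    rcases List.mem_cons.1 hΓ with rfl | hΓ
    · exact List.mem_append_left _ h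
    · exact List.mem_append_right _ (ih hΓ)

/-- Closed reducible instances of typed terms are reducible. -/
theorem NDer.red_psubst {Γ : ℕ → List NTy} {t : NTerm} {σ : NTy} (h : NDer Γ t σ) :
    ∀ {θ : ℕ → NTerm}, (∀ y, (θ y).fv = ∅) → (∀ y, ∀ τ ∈ Γ y, NRed τ (θ y)) →
      NRed σ (t.psubst θ) := by
  have upd_closed : ∀ {θ : ℕ → NTerm} (x : ℕ) {u : NTerm}, u.fv = ∅ →
      (∀ y, (θ y).fv = ∅) → ∀ y, (Function.update θ x u y).fv = ∅ := by
    intro θ x u hu hθ y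
    by_cases e : y = x
    · simp [e, hu]
    · simp [e, hθ]
  have upd_red : ∀ {Γ : ℕ → List NTy} {θ : ℕ → NTerm} {x : ℕ} {u : NTerm} {M : List NTy},
      (∀ τ ∈ M, NRed τ u) → (∀ y, ∀ τ ∈ Γ y, NRed τ (θ y)) →
      ∀ y, ∀ τ ∈ NCtxUpd Γ x M y, NRed τ (Function.update θ x u y) := by
    intro Γ θ x u M hM hΓ y τ hτ
    by_cases e : y = x
    · simp only [NCtxUpd, e, if_true] at hτ
      simpa [e] using hM τ hτ
    · simp only [NCtxUpd, e, if_false] at hτ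
      simpa [e] using hΓ y τ hτ
  induction h with
  | var x σ =>
    intro θ _ hΓ
    exact hΓ x σ (by simp [NCtxSing])
  | @lam Γ x t M σ _ ih =>
    intro θ hθ hΓ
    rw [NRed]
    intro u hu hM
    refine .expand σ (.appLamToSub x _ u) (.expand σ (.root 0 (.subn _ x u)) ?_)
    rw [NTerm.subst_psubst_update t x u hθ]
    exact ih (upd_closed x hu hθ) (upd_red hM hΓ)
  | @app Γ₁ t u σ fam _ _ iht ihu =>
    intro θ hθ hΓ
    have h := iht hθ fun y τ hτ => hΓ y τ (List.mem_append_left _ hτ)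
    rw [NRed] at h
    refine h _ (u.fv_psubst_eq_empty hθ) fun τ hτ => ?_
    obtain ⟨p, hp, rfl⟩ := List.mem_map.1 hτ
    exact ihu p hp hθ fun y τ hτ =>
      hΓ y τ (List.mem_append_right _ (mem_NCtxSum (List.mem_map_of_mem hp) hτ))
  | @es Γ₁ t u x σ fam _ _ iht ihu =>
    intro θ hθ hΓ
    refine .expand σ (.root 0 (.subn _ x _)) ?_
    rw [NTerm.subst_psubst_update t x _ hθ]
    refine iht (upd_closed x (u.fv_psubst_eq_empty hθ) hθ)
      (upd_red (fun τ hτ => ?_) fun y τ hτ => hΓ y τ (List.mem_append_left _ hτ))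
    obtain ⟨p, hp, rfl⟩ := List.mem_map.1 hτ
    exact ihu p hp hθ fun y τ hτ =>
      hΓ y τ (List.mem_append_right _ (mem_NCtxSum (List.mem_map_of_mem hp) hτ))

/-- The testing context binding the variables `xs` to their values under `θ`. -/
def NTCtx.bindVars (θ : ℕ → NTerm) : List ℕ → NTCtx
  | [] => .hole
  | x :: xs => .lamApp x (NTCtx.bindVars θ xs) (θ x)

theorem NTCtx.bindVars_plug_reduces {θ : ℕ → NTerm} (hθ : ∀ y, (θ y).fv = ∅) (t : NTerm)
    (xs : List ℕ) :
    Relation.ReflTransGen (NStep 0) ((NTCtx.bindVars θ xs).plug t)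
      (t.psubst fun y => if y ∈ xs then θ y else .var y) := by
  induction xs with
  | nil => simpa [NTCtx.bindVars, NTCtx.plug] using
      (show Relation.ReflTransGen (NStep 0) t (t.psubst .var) by rw [NTerm.psubst_var])
  | cons x xs ih =>
    refine .head (.appLamToSub x _ (θ x)) ?_
    have hsub := ih.lift (fun s => NTerm.sub s x (θ x)) fun _ _ h => h.subL x (θ x)
    refine hsub.tail ?_
    have hroot := NStep.root 0
      (NRoot.subn (t.psubst fun y => if y ∈ xs then θ y else .var y) x (θ x))
    rw [NTerm.subst_psubst] at hroot
    · convert hroot using 2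
      funext y
      by_cases hy : y ∈ xs
      · simp [hy, NTerm.subst_eq_self (θ x) (show x ∉ (θ y).fv by simp [hθ])]
      · by_cases e : y = x
        · subst e
          simp [hy, NTerm.subst]
        · simp [hy, e, NTerm.subst]
    · intro y
      by_cases hy : y ∈ xs
      · simp [hy, hθ]
      · simp [hy]

theorem NTCtx.exists_plug_eq_apps (T : NTCtx) (t : NTerm) (ws : List NTerm) :
    ∃ T' : NTCtx, T'.plug t = (T.plug t).apps ws := by
  induction ws generalizing T with
  | nil => exact ⟨T, rfl⟩
  | cons w ws ih => exact ih (T.app w)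

theorem Relation.ReflTransGen.apps {t t' : NTerm}
    (h : Relation.ReflTransGen (NStep 0) t t') (ws : List NTerm) :
    Relation.ReflTransGen (NStep 0) (t.apps ws) (t'.apps ws) :=
  h.lift (fun s => s.apps ws) fun _ _ h => h.apps ws

/-- Typable terms are meaningful. -/
theorem NDer.meaningful {Γ : ℕ → List NTy} {t : NTerm} {σ : NTy} (h : NDer Γ t σ) :
    NMeaningful t := by
  let θ : ℕ → NTerm := fun y => NEraserFor (Γ y)
  have hθ : ∀ y, (θ y).fv = ∅ := fun y => fv_NEraser _
  obtain ⟨ws, z, hz⟩ := (h.red_psubst hθ fun y τ hτ => NRed_NEraserFor hτ).solvable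
  have hbind := NTCtx.bindVars_plug_reduces hθ t t.fv.toList
  rw [t.psubst_congr (θ' := θ) fun y hy => by simp [hy]] at hbind
  obtain ⟨T, hT⟩ := (NTCtx.bindVars θ t.fv.toList).exists_plug_eq_apps t ws
  exact ⟨T, z, hT ▸ (hbind.apps ws).trans hz⟩

/-- (λnsub Typed Genericity) If `t` is meaningless and
`Γ ⊢ C⟨t⟩ : σ` is derivable in system 𝒩, then `Γ ⊢ C⟨u⟩ : σ` is derivable
for every term `u`. -/
theorem nsub_typed_genericity (t : NTerm) (ht : ¬ NMeaningful t)
    (C : NFCtx) (Γ : ℕ → List NTy) (σ : NTy)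
    (h : NDer Γ (NFCtx.plug C t) σ) :
    ∀ u : NTerm, NDer Γ (NFCtx.plug C u) σ := by
  intro u
  induction C generalizing Γ σ with
  | hole => exact absurd h.meaningful ht
  | lam x C ih =>
    cases h with
    | lam _ M σ h => exact .lam x M σ (ih _ _ h)
  | appL C s ih =>
    cases h with
    | app _ fam h hs => exact .app σ fam (ih _ _ h) hs
  | appR s C ih =>
    cases h with
    | app _ fam h hs => exact .app σ fam h fun p hp => ih _ _ (hs p hp)
  | subL C x s ih =>
    cases h with
    | es _ _ fam h hs => exact .es x σ fam (ih _ _ h) hs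
  | subR s x C ih =>
    cases h with
    | es _ _ fam h hs => exact .es x σ fam h fun p hp => ih _ _ (hs p hp)
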